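/- Let (Ω, X_n, ℙ_x) be a Markov chain on a nonempty finite set V, let A ⊆ V with ℙ_z(τ_A < ∞) = 1 for every z ∈ V, let b ∈ V ∖ A, set V_1 = V ∖ {b} and A^c = V ∖ A. Let w = (w_0, …, w_η) be a finite path on V with 𝔏_{V_1}(w) = w, w_0 = x, w_η ∈ A and w_n ∉ A for all 0 ≤ n < η, and let (w_{n_0}, …, w_{n_ι}) = w^{[V_1]} be the subsequence of entries of w lying in V_1, in order. Then ℙ_x(𝔏_{V_1}(X|_{[0,τ_A]}) = w) = ( ∏_{n=0}^{η-1} P(w_n, w_{n+1}) ) · ( ∏_{i=0}^{ι-1} G_{A^c ∖ {w_{n_0}, …, w_{n_{i-1}}}}(w_{n_i}, w_{n_i}) ). -/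

import Mathlib

open MeasureTheory

namespace LERW

variable {V : Type*} [DecidableEq V]

/-- The suffix of `l` strictly after the last occurrence of `a` in `l`
(`l` itself if `a` does not occur in `l`). -/
def dropToLastOcc (a : V) (l : List V) : List V :=
  (l.reverse.takeWhile (fun z => z ≠ a)).reverse

lemma dropToLastOcc_length_le (a : V) (l : List V) :
    (dropToLastOcc a l).length ≤ l.length := by
  unfold dropToLastOcc
  calc ((l.reverse.takeWhile (fun z => z ≠ a)).reverse).length
      = (l.reverse.takeWhile (fun z => z ≠ a)).length := by simp
    _ ≤ l.reverse.length := (List.takeWhile_sublist _).length_le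
    _ = l.length := by simp

/-- Partial loop erasure `𝔏_S` of a finite path, associated with a set `S` of vertices. -/
def PLE (S : Finset V) : List V → List V
  | [] => []
  | a :: rest =>
    if a ∈ S then
      if a = (a :: rest).getLast (List.cons_ne_nil a rest) then [a]
      else a :: PLE S (dropToLastOcc a rest)
    else
      if rest = [] then [a]
      else a :: PLE S rest
termination_by l => l.length
decreasing_by
  · simpa using Nat.lt_succ_of_le (dropToLastOcc_length_le a rest)
  · simp

variable [Fintype V]

/-- The (full) loop erasure `𝔏 = 𝔏_V`. -/
def LE : List V → List V := PLE Finset.univ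

/-- Iterated partial loop erasure `𝔏_{W m} ∘ ⋯ ∘ 𝔏_{W 2} ∘ 𝔏_{W 1}`. -/
def iterPLE (W : ℕ → Finset V) : ℕ → List V → List V
  | 0, l => l
  | n + 1, l => PLE (W (n + 1)) (iterPLE W n l)

/-- The remaining suffix `w|_{[n_j , η]}` of the loop-erasing walk of `𝔏` the first time
its current value equals `b` (`[]` if this never happens). -/
def LEsuffixAt (b : V) : List V → List V
  | [] => []
  | a :: rest =>
    if a = b then a :: rest
    else if a = (a :: rest).getLast (List.cons_ne_nil a rest) then []
    else LEsuffixAt b (dropToLastOcc a rest)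
termination_by l => l.length
decreasing_by
  simpa using Nat.lt_succ_of_le (dropToLastOcc_length_le a rest)

/-- Entry time `τ_A` into `A ⊆ V`, valued in `ℕ∞`. -/
noncomputable def entryTime (A : Finset V) (ω : ℕ → V) : ℕ∞ :=
  sInf {m : ℕ∞ | ∃ n : ℕ, m = (n : ℕ∞) ∧ ω n ∈ A}

/-- Entry time `τ_A` as a natural number (junk value `0` when `A` is never visited). -/
noncomputable def entryTimeNat (A : Finset V) (ω : ℕ → V) : ℕ :=
  sInf {n : ℕ | ω n ∈ A}

/-- The random finite path `X|_{[0, τ_A]} = (X_0, X_1, …, X_{τ_A})`. -/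
noncomputable def stoppedPath (A : Finset V) (ω : ℕ → V) : List V :=
  (List.range (entryTimeNat A ω + 1)).map ω

/-- Iterated hitting times `τ̊_W^{(n)}` of `W`, valued in `ℕ∞` (with the convention
`τ̊_W^{(0)} = 0`). -/
noncomputable def iterHit (W : Finset V) (ω : ℕ → V) : ℕ → ℕ∞
  | 0 => 0
  | n + 1 => sInf {m : ℕ∞ | ∃ k : ℕ, m = (k : ℕ∞) ∧ iterHit W ω n < (k : ℕ∞) ∧ ω k ∈ W}

/-- The time `τ̊_W^{(n)} ∧ τ_A`, as a natural number. -/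
noncomputable def traceTime (W A : Finset V) (ω : ℕ → V) (n : ℕ) : ℕ :=
  (iterHit W ω n ⊓ entryTime A ω).toNat

variable [MeasurableSpace V]

/-- The trace process `X̃_n = X_{τ̊_W^{(n)} ∧ τ_A}` (so `X̃_0 = X_0`). -/
noncomputable def traceProc (W A : Finset V) (ω : ℕ → V) (n : ℕ) : V :=
  ω (traceTime W A ω n)

/-- The Green function `G_B(x, y) = 𝔼_x(#{0 ≤ n < τ_{V∖B} : X_n = y})`. -/
noncomputable def green (μ : V → Measure (ℕ → V)) (B : Finset V) (x y : V) : ℝ :=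
  ∑' n : ℕ, (μ x {ω | ω n = y ∧ ∀ k ≤ n, ω k ∈ B}).toReal

section helpers

set_option linter.unusedSectionVars false

variable {V : Type*} [DecidableEq V]

/-- Weight of a path. -/
noncomputable def wt (p : V → V → ENNReal) : List V → ENNReal
  | [] => 1
  | [_] => 1
  | a :: c :: l => p a c * wt p (c :: l)

lemma wt_append (p : V → V → ENNReal) (q : List V) (a c : V) (r : List V) :
    wt p (q ++ a :: c :: r) = wt p (q ++ [a]) * p a c * wt p (c :: r) := by
  induction q with
  | nil => simp [wt]
  | cons d q ih =>
    cases q with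
    | nil => simp [wt, mul_assoc]
    | cons e q => simp only [List.cons_append, wt] at ih ⊢; rw [ih]; ring

lemma wt_map_range (p : V → V → ENNReal) (n : ℕ) (y : ℕ → V) :
    wt p ((List.range (n + 1)).map y) = ∏ i ∈ Finset.range n, p (y i) (y (i + 1)) := by
  induction n generalizing y with
  | zero => simp [wt]
  | succ n ih =>
    have h := ih (fun i => y (i + 1))
    rw [Finset.prod_range_succ', ← h, List.range_succ_eq_map, List.range_succ_eq_map]
    simp [wt, Function.comp_def, mul_comm]

lemma exists_map_range (l : List V) (hl : l ≠ []) :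
    ∃ (n : ℕ) (y : ℕ → V), l = (List.range (n + 1)).map y ∧ l.length = n + 1 := by
  obtain ⟨a, t, rfl⟩ := List.exists_cons_of_ne_nil hl
  refine ⟨t.length, fun i => (a :: t).getD i a, ?_, by simp⟩
  apply List.ext_getElem
  · simp
  · intro i h1 h2
    simp at h1 
    simp [List.getD_eq_getElem?_getD, h1]

/-- Cylinder of a path. -/
def cyl (l : List V) : Set (ℕ → V) := {ω | (List.range l.length).map ω = l}

lemma cyl_map_range (n : ℕ) (y : ℕ → V) :
    cyl ((List.range (n + 1)).map y) = {ω | ∀ i ≤ n, ω i = y i} := by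
  ext ω
  simp [cyl, Nat.lt_succ_iff]

lemma measurableSet_cyl [MeasurableSpace V] [MeasurableSingletonClass V] (l : List V) :
    MeasurableSet (cyl l) := by
  by_cases hl : l = []
  · subst hl; simp [cyl]
  · obtain ⟨n, y, h, -⟩ := exists_map_range l hl
    rw [h, cyl_map_range]
    have : {ω : ℕ → V | ∀ i ≤ n, ω i = y i} = ⋂ i, ⋂ (_ : i ≤ n), (fun ω : ℕ → V => ω i) ⁻¹' {y i} := by
      ext; simp
    rw [this]
    exact MeasurableSet.iInter fun i => MeasurableSet.iInter fun _ =>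
      (measurable_pi_apply i) (measurableSet_singleton _)

lemma measure_cyl [MeasurableSpace V]
    (P : V → V → ℝ) (μ : V → Measure (ℕ → V)) (hP0 : ∀ a b : V, 0 ≤ P a b)
    (hlaw : ∀ (a : V) (n : ℕ) (y : ℕ → V),
      μ a {ω | ∀ i ≤ n, ω i = y i} =
        ENNReal.ofReal ((if a = y 0 then (1 : ℝ) else 0) *
          ∏ i ∈ Finset.Icc 1 n, P (y (i - 1)) (y i))) (a : V) (l : List V) (hl : l ≠ []) :
    μ a (cyl l) = if l.head? = some a then wt (fun a b => ENNReal.ofReal (P a b)) l else 0 := by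
  obtain ⟨n, y, h, -⟩ := exists_map_range l hl
  rw [h, cyl_map_range, hlaw, wt_map_range]
  have h1 : ∏ i ∈ Finset.Icc 1 n, P (y (i - 1)) (y i)
      = ∏ i ∈ Finset.range n, P (y i) (y (i + 1)) := by
    have := Finset.prod_Ico_add' (fun i => P (y (i - 1)) (y i)) 0 n 1
    simp only [Nat.add_sub_cancel, zero_add] at this
    rw [Finset.range_eq_Ico, this]
    rfl
  rw [h1, List.range_succ_eq_map]
  by_cases hh : a = y 0
  · simp [hh, ENNReal.ofReal_prod_of_nonneg, hP0]
  · simp [hh, Ne.symm hh]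

lemma tsum_sub {α : Type*} (S : α → Prop) (f : α → ENNReal) :
    ∑' l : {l // S l}, f l.1 = ∑' l, Set.indicator {l | S l} f l := by
  rw [← tsum_subtype {l | S l} f]
  exact (Equiv.tsum_eq (Equiv.subtypeEquivRight (fun l => by simp) :
    {l // S l} ≃ ({l | S l} : Set α)) (fun l => f l.1))

lemma measure_eq_tsum [Fintype V] [MeasurableSpace V] [MeasurableSingletonClass V]
    (P : V → V → ℝ) (μ : V → Measure (ℕ → V)) (hP0 : ∀ a b : V, 0 ≤ P a b)
    (hlaw : ∀ (a : V) (n : ℕ) (y : ℕ → V),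
      μ a {ω | ∀ i ≤ n, ω i = y i} =
        ENNReal.ofReal ((if a = y 0 then (1 : ℝ) else 0) *
          ∏ i ∈ Finset.Icc 1 n, P (y (i - 1)) (y i))) (a : V)
    (E : Set (ℕ → V)) (f : (ℕ → V) → List V) (S : List V → Prop) (hne : ∀ l, S l → l ≠ [])
    (h1 : ∀ ω ∈ E, S (f ω) ∧ ω ∈ cyl (f ω)) (h2 : ∀ l, S l → ∀ ω ∈ cyl l, ω ∈ E ∧ f ω = l) :
    μ a E = ∑' l : List V, Set.indicator {l | l.head? = some a ∧ S l}
      (wt (fun a b => ENNReal.ofReal (P a b))) l := by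
  have hE : E = ⋃ l : {l // S l}, cyl l.1 := by
    ext ω
    simp only [Set.mem_iUnion]
    constructor
    · intro h; exact ⟨⟨f ω, (h1 ω h).1⟩, (h1 ω h).2⟩
    · rintro ⟨l, hl⟩; exact (h2 l.1 l.2 ω hl).1
  rw [hE, measure_iUnion (μ := μ a) (f := fun l : {l // S l} => cyl l.1) ?_
    (fun l => measurableSet_cyl l.1)]
  · have h3 : ∀ l : {l // S l}, μ a (cyl l.1) =
        (fun l : List V => if l.head? = some a then
          wt (fun a b => ENNReal.ofReal (P a b)) l else 0) l.1 := fun l =>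
      measure_cyl P μ hP0 hlaw a l.1 (hne _ l.2)
    simp_rw [h3]
    rw [tsum_sub S (fun l : List V => if l.head? = some a then
          wt (fun a b => ENNReal.ofReal (P a b)) l else 0)]
    congr 1; ext l
    by_cases hS : S l <;> by_cases hh : l.head? = some a <;> simp [hS, hh, Set.indicator]
  · intro l l' hll
    refine Set.disjoint_left.2 fun ω hω hω' => hll ?_
    exact Subtype.ext ((h2 _ l.2 ω hω).2.symm.trans (h2 _ l'.2 ω hω').2)

/-- Paths stopped on `A` and avoiding `D`. -/
def Good (A D : Finset V) (l : List V) : Prop :=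
  ∃ q z, l = q ++ [z] ∧ z ∈ A ∧ ∀ y ∈ q, y ∉ A ∧ y ∉ D

/-- Loops at `a` inside `B`. -/
def Loop (B : Finset V) (a : V) (l : List V) : Prop :=
  l.head? = some a ∧ l.getLast? = some a ∧ ∀ y ∈ l, y ∈ B

lemma Good.ne_nil {A D : Finset V} {l : List V} (h : Good A D l) : l ≠ [] := by
  obtain ⟨q, z, rfl, -⟩ := h; simp

lemma good_append {A D : Finset V} (q r : List V) (hr : r ≠ []) :
    Good A D (q ++ r) ↔ (∀ y ∈ q, y ∉ A ∧ y ∉ D) ∧ Good A D r := by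
  constructor
  · rintro ⟨q', z, h, hz, hq⟩
    obtain ⟨r', z', rfl⟩ := (List.eq_nil_or_concat r).resolve_left hr
    rw [List.concat_eq_append, ← List.append_assoc] at h
    obtain ⟨h, h'⟩ := List.append_inj' h rfl
    subst h
    obtain rfl : z' = z := by simpa using h'
    exact ⟨fun y hy => hq y (by simp [hy]), r', z', by simp, hz, fun y hy => hq y (by simp [hy])⟩
  · rintro ⟨h, r', z, rfl, hz, h'⟩
    refine ⟨q ++ r', z, by simp, hz, ?_⟩
    intro y hy
    rcases List.mem_append.1 hy with hy | hy
    exacts [h y hy, h' y hy]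

lemma good_insert {A D : Finset V} {a : V} (ha : a ∉ A) (r : List V) :
    Good A (insert a D) r ↔ Good A D r ∧ a ∉ r := by
  constructor
  · rintro ⟨q, z, rfl, hz, hq⟩
    refine ⟨⟨q, z, rfl, hz, fun y hy => ⟨(hq y hy).1, fun h => (hq y hy).2 (by simp [h])⟩⟩, ?_⟩
    simp only [List.mem_append, List.mem_singleton, not_or]
    refine ⟨fun h => (hq a h).2 (by simp), fun h => ha (h ▸ hz)⟩
  · rintro ⟨⟨q, z, rfl, hz, hq⟩, h⟩
    refine ⟨q, z, rfl, hz, fun y hy => ⟨(hq y hy).1, ?_⟩⟩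
    simp only [Finset.mem_insert, not_or]
    exact ⟨fun e => h (by simp [← e, hy]), (hq y hy).2⟩

lemma drop_notMem (a : V) (r : List V) (h : a ∉ r) : dropToLastOcc a r = r := by
  unfold dropToLastOcc
  rw [List.takeWhile_eq_self_iff.2, List.reverse_reverse]
  intro x hx
  simp only [List.mem_reverse] at hx
  simp only [ne_eq, decide_not, Bool.not_eq_eq_eq_not, Bool.not_true, decide_eq_false_iff_not]
  rintro rfl; exact h hx

lemma drop_append (a : V) (q r : List V) (h : a ∉ r) : dropToLastOcc a (q ++ a :: r) = r := by
  unfold dropToLastOcc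
  rw [List.reverse_append, List.reverse_cons, List.append_assoc, List.takeWhile_append_of_pos]
  · simp
  · intro x hx
    simp only [List.mem_reverse] at hx
    simp only [ne_eq, decide_not, Bool.not_eq_eq_eq_not, Bool.not_true, decide_eq_false_iff_not]
    rintro rfl; exact h hx

lemma PLE_head (S : Finset V) (a : V) (l : List V) : ∃ t, PLE S (a :: l) = a :: t := by
  rw [PLE]; split_ifs <;> exact ⟨_, rfl⟩

lemma PLE_singleton (S : Finset V) (a : V) : PLE S [a] = [a] := by
  rw [PLE]; simp

lemma head_of_PLE {S : Finset V} {a : V} {l u : List V} (h : PLE S l = a :: u) :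
    ∃ t, l = a :: t := by
  cases l with
  | nil => simp [PLE] at h
  | cons c l =>
    obtain ⟨t, ht⟩ := PLE_head S c l
    rw [ht] at h
    obtain rfl : c = a := by simpa using (List.cons.inj h).1
    exact ⟨l, rfl⟩

lemma PLE_loop (S : Finset V) (a : V) (ha : a ∈ S) (q r : List V) (hr : r ≠ []) (har : a ∉ r)
    (hh : (q ++ [a]).head? = some a) : PLE S (q ++ a :: r) = a :: PLE S r := by
  cases q with
  | nil =>
    have hl : a ≠ (a :: r).getLast (List.cons_ne_nil a r) := by
      rw [List.getLast_cons hr]; intro h; exact har (by rw [h]; exact List.getLast_mem hr)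
    rw [List.nil_append, PLE, if_pos ha, if_neg hl, drop_notMem _ _ har]
  | cons d q =>
    obtain rfl : d = a := by simpa using hh
    have hl : d ≠ (d :: (q ++ d :: r)).getLast (List.cons_ne_nil _ _) := by
      rw [List.getLast_cons (by simp), List.getLast_append_of_ne_nil _ (by simp), List.getLast_cons hr]
      intro h; exact har (by rw [h]; exact List.getLast_mem hr)
    rw [List.cons_append, PLE, if_pos ha, if_neg hl, drop_append _ _ _ har]

lemma PLE_skip (S : Finset V) (a : V) (ha : a ∉ S) (r : List V) (hr : r ≠ []) :
    PLE S (a :: r) = a :: PLE S r := by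
  rw [PLE, if_neg ha, if_neg hr]

lemma last_occ (a : V) (s : List V) (h : a ∈ s) : ∃ q r, s = q ++ a :: r ∧ a ∉ r := by
  induction s with
  | nil => simp at h
  | cons c s ih =>
    by_cases hs : a ∈ s
    · obtain ⟨q, r, rfl, hr⟩ := ih hs
      exact ⟨c :: q, r, rfl, hr⟩
    · rcases List.mem_cons.1 h with rfl | h
      · exact ⟨[], s, rfl, hs⟩
      · exact absurd h hs

/-- Total weight of good paths with erasure `u`. -/
noncomputable def FF (p : V → V → ENNReal) (S A D : Finset V) (u : List V) : ENNReal :=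
  ∑' l : {l // Good A D l ∧ PLE S l = u}, wt p l.1

/-- Green function as a loop sum. -/
noncomputable def GG (p : V → V → ENNReal) (B : Finset V) (a : V) : ENNReal :=
  ∑' l : {l // Loop B a l}, wt p l.1

lemma FF_base (p : V → V → ENNReal) (S A D : Finset V) (z : V) (hz : z ∈ A) :
    FF p S A D [z] = 1 := by
  have key : ∀ l, Good A D l ∧ PLE S l = [z] → l = [z] := by
    rintro l ⟨hg, hl⟩
    obtain ⟨t, rfl⟩ := head_of_PLE hl
    by_contra hne
    have ht : t ≠ [] := fun h => hne (by rw [h])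
    have := (good_append [z] t ht).1 hg
    exact (this.1 z (by simp)).1 hz
  have h0 : Good A D [z] ∧ PLE S [z] = [z] := ⟨⟨[], z, rfl, hz, by simp⟩, PLE_singleton S z⟩
  unfold FF
  rw [tsum_eq_single ⟨[z], h0⟩]
  · rfl
  · intro l hl; exact absurd (Subtype.ext (key l.1 l.2)) hl

lemma FF_skip (p : V → V → ENNReal) (S A D : Finset V) (a c : V) (u : List V) (ha : a ∉ S)
    (haA : a ∉ A) (haD : a ∉ D) :
    FF p S A D (a :: c :: u) = p a c * FF p S A D (c :: u) := by
  let e : {r // Good A D r ∧ PLE S r = c :: u} → {s // Good A D s ∧ PLE S s = a :: c :: u} :=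
    fun r => ⟨a :: r.1, (good_append [a] r.1 r.2.1.ne_nil).2 ⟨by simp [haA, haD], r.2.1⟩,
      by rw [PLE_skip S a ha r.1 r.2.1.ne_nil, r.2.2]⟩
  have he : Function.Bijective e := by
    constructor
    · intro r r' h
      have := congrArg Subtype.val h
      exact Subtype.ext (by simpa [e] using this)
    · rintro ⟨s, hg, hs⟩
      obtain ⟨t, rfl⟩ := head_of_PLE hs
      have ht : t ≠ [] := by
        rintro rfl; rw [PLE_singleton] at hs; simp at hs
      rw [PLE_skip S a ha t ht] at hs
      exact ⟨⟨t, ((good_append [a] t ht).1 hg).2, by simpa using hs⟩, rfl⟩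
  unfold FF
  rw [← (Equiv.ofBijective e he).tsum_eq, ← ENNReal.tsum_mul_left]
  congr 1; ext r
  obtain ⟨t, ht⟩ := head_of_PLE r.2.2
  simp [e, ht, wt]

lemma FF_loop [Fintype V] (p : V → V → ENNReal) (S A D : Finset V) (a c : V) (u : List V)
    (ha : a ∈ S) (haA : a ∉ A) :
    FF p S A D (a :: c :: u) =
      GG p (Aᶜ \ D) a * p a c * FF p S A (insert a D) (c :: u) := by
  let e : {l // Loop (Aᶜ \ D) a l} × {r // Good A (insert a D) r ∧ PLE S r = c :: u} →
      {s // Good A D s ∧ PLE S s = a :: c :: u} :=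
    fun x => ⟨x.1.1 ++ x.2.1, by
      obtain ⟨⟨l, hh, hl, hB⟩, ⟨r, hg, hr⟩⟩ := x
      have hn := hg.ne_nil
      rw [good_insert haA] at hg
      dsimp only
      refine ⟨(good_append l r hn).2 ⟨fun y hy => by simpa using hB y hy, hg.1⟩, ?_⟩
      obtain ⟨q, rfl⟩ := List.getLast?_eq_some_iff.1 hl
      rw [List.append_assoc, List.singleton_append, PLE_loop S a ha q r hn hg.2 hh, hr]⟩
  have he : Function.Bijective e := by
    constructor
    · rintro ⟨⟨l, hh, hl, hB⟩, ⟨r, hg, hr⟩⟩ ⟨⟨l', hh', hl', hB'⟩, ⟨r', hg', hr'⟩⟩ h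
      have h := congrArg Subtype.val h
      simp only [e] at h
      obtain ⟨q, rfl⟩ := List.getLast?_eq_some_iff.1 hl
      obtain ⟨q', rfl⟩ := List.getLast?_eq_some_iff.1 hl'
      rw [good_insert haA] at hg hg'
      have h1 := congrArg (dropToLastOcc a) h
      simp only [List.append_assoc, List.singleton_append] at h1
      rw [drop_append _ _ _ hg.2, drop_append _ _ _ hg'.2] at h1
      subst h1
      have h2 := List.append_cancel_right h
      simp only [h2]
    · rintro ⟨s, hg, hs⟩
      obtain ⟨t, ht⟩ := head_of_PLE hs
      obtain ⟨q, r, hqr, har⟩ := last_occ a s (by simp [ht])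
      have hr : r ≠ [] := by
        rintro rfl
        obtain ⟨q', z, h, hz, -⟩ := hg
        rw [hqr] at h
        have := List.append_inj' h rfl
        apply haA
        have : a = z := by simpa using this.2
        rwa [this]
      have hh : (q ++ [a]).head? = some a := by
        rw [hqr] at ht
        cases q with
        | nil => simp
        | cons d q => simp at ht; simp [ht.1]
      subst hqr
      rw [PLE_loop S a ha q r hr har hh] at hs
      have hs' : PLE S r = c :: u := by simpa using hs
      have hg' : Good A D ((q ++ [a]) ++ r) := by simpa using hg
      rw [good_append _ _ hr] at hg'
      refine ⟨⟨⟨q ++ [a], hh, by simp, fun y hy => by simpa using hg'.1 y hy⟩,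
        ⟨r, (good_insert haA r).2 ⟨hg'.2, har⟩, hs'⟩⟩, ?_⟩
      apply Subtype.ext
      simp [e]
  unfold FF GG
  rw [← (Equiv.ofBijective e he).tsum_eq, ENNReal.tsum_prod', ← ENNReal.tsum_mul_right,
    ← ENNReal.tsum_mul_right]
  congr 1; ext l
  rw [← ENNReal.tsum_mul_left]
  congr 1; ext r
  obtain ⟨t, ht⟩ := head_of_PLE r.2.2
  obtain ⟨q, hq⟩ := List.getLast?_eq_some_iff.1 l.2.2.1
  simp only [Equiv.ofBijective_apply, e, ht, hq, List.append_assoc, List.singleton_append]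
  rw [wt_append]

lemma FF_eq [Fintype V] (p : V → V → ENNReal) (A : Finset V) (b : V) (hb : b ∉ A) (η : ℕ)
    (w : ℕ → V) (hη : w η ∈ A) (hmid : ∀ n < η, w n ∉ A) (m : ℕ) :
    ∀ k, k + m = η →
    FF p (Finset.univ \ {b}) A (((Finset.range k).filter (fun n => w n ≠ b)).image w)
      ((List.range' k (m + 1)).map w) =
    ∏ n ∈ Finset.Ico k η, (p (w n) (w (n + 1)) * if w n ≠ b then
      GG p (Aᶜ \ ((Finset.range n).filter (fun n => w n ≠ b)).image w) (w n) else 1) := by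
  induction m with
  | zero =>
    intro k hk
    obtain rfl : k = η := by omega
    simp [FF_base, hη]
  | succ m ih =>
    intro k hk
    have h := ih (k + 1) (by omega)
    rw [Finset.prod_eq_prod_Ico_succ_bot (by omega), ← h]
    simp only [List.range'_succ, List.map_cons]
    have hkA := hmid k (by omega)
    by_cases hw : w k = b
    · rw [FF_skip _ _ _ _ _ _ _ (by simp [hw]) hkA (by simp [hw])]
      simp [Finset.range_add_one, Finset.filter_insert, hw]
    · rw [FF_loop _ _ _ _ _ _ _ (by simp [hw]) hkA]
      simp only [Finset.range_add_one, Finset.filter_insert, hw, ne_eq, not_false_eq_true, if_true,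
        Finset.image_insert]
      ring

end helpers

lemma entryTime_of_cyl {V : Type*} [DecidableEq V] [Fintype V] (A D : Finset V) (l : List V)
    (hl : Good A D l) (ω : ℕ → V) (h : ω ∈ cyl l) :
    (∃ n, ω n ∈ A) ∧ stoppedPath A ω = l := by
  obtain ⟨q, z, rfl, hz, hq⟩ := hl
  simp only [cyl, Set.mem_ofPred_eq, List.length_append, List.length_singleton] at h
  have h' := h
  rw [List.range_succ, List.map_append] at h'
  have h' := List.append_inj' h' rfl
  have hA : ω q.length ∈ A := by
    have : ω q.length = z := by simpa using h'.2
    rwa [this]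
  refine ⟨⟨_, hA⟩, ?_⟩
  have ht : entryTimeNat A ω = q.length := by
    unfold entryTimeNat
    apply le_antisymm (Nat.sInf_le (s := {n : ℕ | ω n ∈ A}) hA)
    by_contra hlt
    push Not at hlt
    have hn : ω (sInf {n : ℕ | ω n ∈ A}) ∈ A := Nat.sInf_mem (s := {n : ℕ | ω n ∈ A}) ⟨_, hA⟩
    generalize sInf {n : ℕ | ω n ∈ A} = n at hn hlt
    refine (hq (ω n) ?_).1 hn
    rw [← h'.1]
    exact List.mem_map.2 ⟨n, List.mem_range.2 hlt, rfl⟩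
  rw [stoppedPath, ht, h]

lemma good_stoppedPath {V : Type*} [DecidableEq V] [Fintype V] (A : Finset V) (ω : ℕ → V)
    (h : ∃ n, ω n ∈ A) : Good A ∅ (stoppedPath A ω) ∧ ω ∈ cyl (stoppedPath A ω) := by
  refine ⟨⟨(List.range (entryTimeNat A ω)).map ω, ω (entryTimeNat A ω), ?_, ?_, ?_⟩, ?_⟩
  · rw [stoppedPath, List.range_succ, List.map_append]; rfl
  · exact Nat.sInf_mem (s := {n | ω n ∈ A}) h
  · intro y hy
    obtain ⟨n, hn, rfl⟩ := List.mem_map.1 hy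
    exact ⟨Nat.notMem_of_lt_sInf (List.mem_range.1 hn), by simp⟩
  · simp [stoppedPath, cyl]

lemma green_eq {V : Type*} [Fintype V] [DecidableEq V]
    [MeasurableSpace V] [MeasurableSingletonClass V]
    (P : V → V → ℝ) (μ : V → Measure (ℕ → V))
    (hP0 : ∀ a b : V, 0 ≤ P a b)
    (hprob : ∀ a : V, IsProbabilityMeasure (μ a))
    (hlaw : ∀ (a : V) (n : ℕ) (y : ℕ → V),
      μ a {ω | ∀ i ≤ n, ω i = y i} =
        ENNReal.ofReal ((if a = y 0 then (1 : ℝ) else 0) *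
          ∏ i ∈ Finset.Icc 1 n, P (y (i - 1)) (y i))) (B : Finset V) (a : V) :
    green μ B a a = (GG (fun a b => ENNReal.ofReal (P a b)) B a).toReal := by
  unfold green
  rw [← ENNReal.tsum_toReal_eq (fun n => measure_ne_top _ _)]
  congr 1
  have h1 : ∀ n : ℕ, μ a {ω | ω n = a ∧ ∀ k ≤ n, ω k ∈ B} = _ := fun n =>
    measure_eq_tsum P μ hP0 hlaw a {ω | ω n = a ∧ ∀ k ≤ n, ω k ∈ B}
      (fun ω => (List.range (n + 1)).map ω)
      (fun l => l.length = n + 1 ∧ l.getLast? = some a ∧ ∀ y ∈ l, y ∈ B)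
      (by rintro l ⟨h, -⟩ rfl; simp at h)
      (by
        rintro ω ⟨h, h'⟩
        refine ⟨⟨by simp, ?_, ?_⟩, by simp [cyl]⟩
        · rw [List.range_succ]; simp [h]
        · intro y hy
          obtain ⟨k, hk, rfl⟩ := List.mem_map.1 hy
          exact h' k (Nat.lt_succ_iff.1 (List.mem_range.1 hk)))
      (by
        rintro l ⟨hn, hl, hB⟩ ω hω
        simp only [cyl, Set.mem_ofPred_eq, hn] at hω
        refine ⟨⟨?_, ?_⟩, hω⟩
        · rw [← hω, List.range_succ] at hl; simpa using hl
        · intro k hk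
          apply hB; rw [← hω]
          exact List.mem_map.2 ⟨k, List.mem_range.2 (by omega), rfl⟩)
  simp_rw [h1]
  rw [ENNReal.tsum_comm]
  unfold GG
  rw [tsum_sub (Loop B a) (wt fun a b => ENNReal.ofReal (P a b))]
  congr 1; ext l
  rw [tsum_eq_single (l.length - 1)]
  · have : l.head? = some a → l.length = l.length - 1 + 1 := by
      cases l <;> simp
    unfold Set.indicator Loop
    congr 1
    simp only [Set.mem_ofPred_eq, eq_iff_iff]
    tauto
  · intro n hn
    apply Set.indicator_of_notMem
    rintro ⟨-, h, -⟩
    omega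

theorem prob_partial_loop_erasure_eq_green_product
    {V : Type*} [Fintype V] [DecidableEq V] [Nonempty V]
    [MeasurableSpace V] [MeasurableSingletonClass V]
    (P : V → V → ℝ) (μ : V → Measure (ℕ → V))
    (hP0 : ∀ a b : V, 0 ≤ P a b) (hP1 : ∀ a : V, ∑ b : V, P a b = 1)
    (hprob : ∀ a : V, IsProbabilityMeasure (μ a))
    (hlaw : ∀ (a : V) (n : ℕ) (y : ℕ → V),
      μ a {ω | ∀ i ≤ n, ω i = y i} =
        ENNReal.ofReal ((if a = y 0 then (1 : ℝ) else 0) *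
          ∏ i ∈ Finset.Icc 1 n, P (y (i - 1)) (y i)))
    (A : Finset V) (hA : ∀ z : V, μ z {ω | ∃ n : ℕ, ω n ∈ A} = 1)
    (b : V) (hbA : b ∉ A)
    (x : V) (η : ℕ) (w : ℕ → V)
    (h0 : w 0 = x) (hη : w η ∈ A) (hmid : ∀ n < η, w n ∉ A)
    (hfix : PLE (Finset.univ \ {b}) ((List.range (η + 1)).map w) = (List.range (η + 1)).map w)
    (ι : ℕ) (ns : ℕ → ℕ)
    (hmono : ∀ i j : ℕ, i < j → j ≤ ι → ns i < ns j)
    (hrange : ∀ i ≤ ι, ns i ≤ η ∧ w (ns i) ≠ b)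
    (hfull : ∀ n ≤ η, w n ≠ b → ∃ i ≤ ι, ns i = n) :
    (μ x {ω | (∃ n : ℕ, ω n ∈ A) ∧
        PLE (Finset.univ \ {b}) (stoppedPath A ω) = (List.range (η + 1)).map w}).toReal =
      (∏ n ∈ Finset.range η, P (w n) (w (n + 1))) *
        ∏ i ∈ Finset.range ι,
          green μ (Aᶜ \ (Finset.range i).image (fun j => w (ns j))) (w (ns i)) (w (ns i)) := by
  set p : V → V → ENNReal := fun a b => ENNReal.ofReal (P a b) with hp
  have hE : μ x {ω | (∃ n : ℕ, ω n ∈ A) ∧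
        PLE (Finset.univ \ {b}) (stoppedPath A ω) = (List.range (η + 1)).map w} =
      FF p (Finset.univ \ {b}) A ∅ ((List.range (η + 1)).map w) := by
    rw [measure_eq_tsum P μ hP0 hlaw x _ (stoppedPath A)
      (fun l => Good A ∅ l ∧ PLE (Finset.univ \ {b}) l = (List.range (η + 1)).map w)
      (fun l h => h.1.ne_nil)
      (fun ω h => ⟨⟨(good_stoppedPath A ω h.1).1, h.2⟩, (good_stoppedPath A ω h.1).2⟩)
      (fun l h ω hω => by
        obtain ⟨h1, h2⟩ := entryTime_of_cyl A ∅ l h.1 ω hω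
        exact ⟨⟨h1, by rw [h2]; exact h.2⟩, h2⟩)]
    unfold FF
    rw [tsum_sub (fun l => Good A ∅ l ∧ PLE (Finset.univ \ {b}) l = (List.range (η + 1)).map w)
      (wt p)]
    congr 1; ext l
    unfold Set.indicator
    congr 1
    simp only [Set.mem_ofPred_eq, eq_iff_iff, and_iff_right_iff_imp]
    rintro ⟨-, h⟩
    rw [List.range_succ_eq_map, List.map_cons] at h
    obtain ⟨t, rfl⟩ := head_of_PLE h
    simp [h0]
  have hF := FF_eq p A b hbA η w hη hmid η 0 (by omega)
  rw [← List.range_eq_range'] at hF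
  simp only [Finset.range_zero, Finset.filter_empty, Finset.image_empty] at hF
  rw [hE, hF, Finset.prod_mul_distrib, ENNReal.toReal_mul, ENNReal.toReal_prod,
    ← Finset.range_eq_Ico]
  congr 1
  · exact Finset.prod_congr rfl fun n _ => ENNReal.toReal_ofReal (hP0 _ _)
  · rw [← Finset.prod_filter, ENNReal.toReal_prod]
    have hι : ns ι = η := by
      obtain ⟨i, hi, h⟩ := hfull η le_rfl (fun h => hbA (h ▸ hη))
      rcases hi.lt_or_eq with hlt | rfl
      · have := hmono i ι hlt le_rfl
        have := (hrange ι le_rfl).1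
        omega
      · exact h
    have himg : ∀ i ≤ ι, ((Finset.range (ns i)).filter (fun n => w n ≠ b)).image w =
        (Finset.range i).image (fun j => w (ns j)) := by
      intro i hi
      ext v
      simp only [Finset.mem_image, Finset.mem_filter, Finset.mem_range]
      constructor
      · rintro ⟨n, ⟨hn, hb⟩, rfl⟩
        obtain ⟨j, hj, rfl⟩ := hfull n (by have := (hrange i hi).1; omega) hb
        refine ⟨j, ?_, rfl⟩
        by_contra hji
        push Not at hji
        rcases hji.lt_or_eq with hlt | rfl
        · have := hmono i j hlt hj; omega
        · omega
      · rintro ⟨j, hj, rfl⟩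
        exact ⟨ns j, ⟨hmono j i hj hi, (hrange j (by omega)).2⟩, rfl⟩
    symm
    refine Finset.prod_bij (fun i _ => ns i) ?_ ?_ ?_ ?_
    · intro i hi
      have hi := Finset.mem_range.1 hi
      simp only [Finset.mem_filter, Finset.mem_range]
      exact ⟨hι ▸ hmono i ι hi le_rfl, (hrange i hi.le).2⟩
    · intro i hi j hj hij
      have hi := Finset.mem_range.1 hi
      have hj := Finset.mem_range.1 hj
      rcases lt_trichotomy i j with h | h | h
      · have := hmono i j h hj.le; omega
      · exact h
      · have := hmono j i h hi.le; omega
    · intro n hn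
      simp only [Finset.mem_filter, Finset.mem_range] at hn
      obtain ⟨i, hi, rfl⟩ := hfull n hn.1.le hn.2
      refine ⟨i, Finset.mem_range.2 (lt_of_le_of_ne hi ?_), rfl⟩
      rintro rfl
      omega
    · intro i hi
      have hi := Finset.mem_range.1 hi
      rw [himg i hi.le, green_eq P μ hP0 hprob hlaw]

end LERW
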